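/- Pairwise form of the equivalence theorem: under the setting of Lemma 2 (counts x : Fin K → ℕ with ∑_j x_j = N, post-assignment entropies H^{(k)}, L(k) = C·φ(z; μ_k, Σ_k) with C > 0 and Σ_k positive definite), define for λ ≥ 0 the exact objective F(k) = log L(k) + λ·H^{(k)} and the greedy surrogate G(k) = −d(z, μ_k, Σ_k) − (λ/(N+1))·log(x_k + 1). Then for all clusters k, k': | (F(k) − F(k')) − (G(k) − G(k')) | ≤ λ/(N+1). -/

import Mathlib

open Real Matrix Finset

/-- The multivariate Gaussian density
`φ(z; μ, Σ) = exp(−½ (z−μ)ᵀ Σ⁻¹ (z−μ)) / √((2π)^d · det Σ)`. -/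
noncomputable def gaussDensity {d : ℕ} (z μ : Fin d → ℝ) (S : Matrix (Fin d) (Fin d) ℝ) : ℝ :=
  Real.exp (-(1 / 2) * ((z - μ) ⬝ᵥ (S⁻¹ *ᵥ (z - μ)))) / Real.sqrt ((2 * Real.pi) ^ d * S.det)

/-- The Gaussian cost
`d(z, μ, Σ) = ½ (z−μ)ᵀ Σ⁻¹ (z−μ) + ½ log(det Σ) + (d/2) log(2π)`. -/
noncomputable def gaussCost {d : ℕ} (z μ : Fin d → ℝ) (S : Matrix (Fin d) (Fin d) ℝ) : ℝ :=
  (1 / 2) * ((z - μ) ⬝ᵥ (S⁻¹ *ᵥ (z - μ))) + (1 / 2) * Real.log S.det +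
    ((d : ℝ) / 2) * Real.log (2 * Real.pi)

/-- The counts after assigning one more point to cluster `k`:
`x'ⱼ = xⱼ + 1` if `j = k` and `x'ⱼ = xⱼ` otherwise. -/
def postCounts {K : ℕ} (x : Fin K → ℕ) (k : Fin K) (j : Fin K) : ℕ :=
  if j = k then x j + 1 else x j

/-- `H^{(k)}`: the Shannon entropy of the empirical distribution `(x'ⱼ/(N+1))ⱼ` of cluster
sizes after one more point has been assigned to cluster `k` (with the convention
`0·log 0 = 0`, which holds definitionally since `Real.log 0 = 0`). -/
noncomputable def postEnt {K : ℕ} (N : ℕ) (x : Fin K → ℕ) (k : Fin K) : ℝ :=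
  -∑ j, ((postCounts x k j : ℝ) / ((N : ℝ) + 1)) *
      Real.log ((postCounts x k j : ℝ) / ((N : ℝ) + 1))

/-- `g(x) = (x+1) log(x+1) − x log x` (with the convention `0·log 0 = 0`). -/
noncomputable def gFun (x : ℝ) : ℝ :=
  (x + 1) * Real.log (x + 1) - x * Real.log x

theorem log_gaussDensity {d : ℕ} (z μ : Fin d → ℝ) {S : Matrix (Fin d) (Fin d) ℝ}
    (hS : S.PosDef) : Real.log (gaussDensity z μ S) = -gaussCost z μ S := by
  have hdet := hS.det_pos
  have hpi : (0 : ℝ) < (2 * Real.pi) ^ d := by positivity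
  rw [gaussDensity, gaussCost, Real.log_div (Real.exp_ne_zero _) (by positivity), Real.log_exp,
    Real.log_sqrt (by positivity), Real.log_mul hpi.ne' hdet.ne', Real.log_pow]
  ring

theorem gaussDensity_pos {d : ℕ} (z μ : Fin d → ℝ) {S : Matrix (Fin d) (Fin d) ℝ}
    (hS : S.PosDef) : 0 < gaussDensity z μ S := by
  have hdet := hS.det_pos
  rw [gaussDensity]
  positivity

theorem sum_postCounts {K : ℕ} (x : Fin K → ℕ) (k : Fin K) (f : ℕ → ℝ) :
    ∑ j, f (postCounts x k j) = ∑ j, f (x j) + (f (x k + 1) - f (x k)) := by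
  rw [← sub_eq_iff_eq_add', ← Finset.sum_sub_distrib, Finset.sum_eq_single k]
  · simp [postCounts]
  · intro j _ hj
    simp [postCounts, hj]
  · simp

theorem postEnt_eq {K N : ℕ} (x : Fin K → ℕ) (hx : ∑ j, x j = N) (k : Fin K) :
    postEnt N x k = Real.log ((N : ℝ) + 1) -
      (∑ j, (x j : ℝ) * Real.log (x j) + gFun (x k)) / ((N : ℝ) + 1) := by
  have hN : (N : ℝ) + 1 ≠ 0 := by positivity
  have hterm (m : ℕ) : (m : ℝ) / (N + 1) * Real.log ((m : ℝ) / (N + 1)) =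
      (m * Real.log m - m * Real.log ((N : ℝ) + 1)) / (N + 1) := by
    rcases eq_or_ne (m : ℝ) 0 with hm | hm
    · simp [hm]
    · rw [Real.log_div hm hN]
      ring
  have hcount : ∑ j, (x j : ℝ) = N := by exact_mod_cast hx
  simp only [postEnt, hterm]
  rw [← Finset.sum_div, Finset.sum_sub_distrib, ← Finset.sum_mul,
    sum_postCounts x k (fun m => (m : ℝ) * Real.log m), sum_postCounts x k (fun m => (m : ℝ)),
    hcount, gFun]
  push_cast
  field_simp
  ring

theorem gFun_sub_log_mem_Icc {t : ℝ} (ht : 0 ≤ t) :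
    gFun t - Real.log (t + 1) ∈ Set.Icc 0 1 := by
  have hrw : gFun t - Real.log (t + 1) = t * (Real.log (t + 1) - Real.log t) := by
    rw [gFun]
    ring
  rw [hrw]
  rcases ht.eq_or_lt with rfl | ht
  · simp
  refine ⟨mul_nonneg ht.le (sub_nonneg.2 (Real.log_le_log ht (by linarith))), ?_⟩
  have hlog : Real.log ((t + 1) / t) ≤ (t + 1) / t - 1 :=
    Real.log_le_sub_one_of_pos (by positivity)
  rw [← Real.log_div (by positivity) ht.ne']
  calc t * Real.log ((t + 1) / t) ≤ t * ((t + 1) / t - 1) := by gcongr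
    _ = 1 := by field_simp; ring

/-- Pairwise form of the equivalence theorem: with the exact objective
`F(k) = log (C·φ(z; μₖ, Σₖ)) + λ·H^{(k)}` and the greedy surrogate
`G(k) = −d(z, μₖ, Σₖ) − (λ/(N+1))·log(xₖ + 1)`, for `λ ≥ 0` and all clusters `k, k'`:
`| (F(k) − F(k')) − (G(k) − G(k')) | ≤ λ/(N+1)`. -/
theorem pairwise_surrogate_bound {K N d : ℕ} (x : Fin K → ℕ) (hx : ∑ j, x j = N)
    (z : Fin d → ℝ) (μ : Fin K → Fin d → ℝ) (S : Fin K → Matrix (Fin d) (Fin d) ℝ)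
    (hS : ∀ k, (S k).PosDef) (C : ℝ) (hC : 0 < C) (lam : ℝ) (hlam : 0 ≤ lam) (k k' : Fin K) :
    |((Real.log (C * gaussDensity z (μ k) (S k)) + lam * postEnt N x k) -
        (Real.log (C * gaussDensity z (μ k') (S k')) + lam * postEnt N x k')) -
      ((-gaussCost z (μ k) (S k) - (lam / ((N : ℝ) + 1)) * Real.log ((x k : ℝ) + 1)) -
        (-gaussCost z (μ k') (S k') -
          (lam / ((N : ℝ) + 1)) * Real.log ((x k' : ℝ) + 1)))| ≤
      lam / ((N : ℝ) + 1) := by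
  have hlog (i : Fin K) : Real.log (C * gaussDensity z (μ i) (S i)) =
      Real.log C - gaussCost z (μ i) (S i) := by
    rw [Real.log_mul hC.ne' (gaussDensity_pos z (μ i) (hS i)).ne', log_gaussDensity z (μ i) (hS i),
      sub_eq_add_neg]
  obtain ⟨h0, h1⟩ := gFun_sub_log_mem_Icc (Nat.cast_nonneg (α := ℝ) (x k))
  obtain ⟨h0', h1'⟩ := gFun_sub_log_mem_Icc (Nat.cast_nonneg (α := ℝ) (x k'))
  rw [hlog, hlog, postEnt_eq x hx, postEnt_eq x hx]
  calc _ = |lam / ((N : ℝ) + 1) * ((gFun (x k') - Real.log ((x k' : ℝ) + 1)) -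
        (gFun (x k) - Real.log ((x k : ℝ) + 1)))| := by
        congr 1
        ring
    _ = lam / ((N : ℝ) + 1) * |(gFun (x k') - Real.log ((x k' : ℝ) + 1)) -
        (gFun (x k) - Real.log ((x k : ℝ) + 1))| := by
        rw [abs_mul, abs_of_nonneg (by positivity)]
    _ ≤ lam / ((N : ℝ) + 1) :=
        mul_le_of_le_one_right (by positivity) (abs_le.2 ⟨by linarith, by linarith⟩)
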